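/- arXiv:2407.15271 — 2 statements merged into one kernel-verified Lean document; each statement's English description precedes it below -/
import Mathlib

section
/- Let (Ξ,Θ,Γ) be a G-complete fuzzy metric space whose t-norm Γ is of H-type and such that lim_{ρ→∞} Θ(u,v,ρ) = 1 for all u,v ∈ Ξ. If S : Ξ → K(Ξ) is a ζ-contraction multi-valued mapping for some ζ ∈ Π, then S possesses a fixed point, i.e., there exists u ∈ Ξ with u ∈ S(u). -/
open Filter Topology

/-- A fuzzy metric space in the sense of George and Veeramani:
`Θ : Ξ × Ξ × (0,∞) → (0,1]` together with a continuous t-norm `Γ` on `[0,1]`. -/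
structure FuzzyMetricSpace (Ξ : Type*) where
  Θ : Ξ → Ξ → ℝ → ℝ
  Γ : ℝ → ℝ → ℝ
  Γ_comm : ∀ a b, Γ a b = Γ b a
  Γ_assoc : ∀ a b c, Γ (Γ a b) c = Γ a (Γ b c)
  Γ_mono : ∀ a ∈ Set.Icc (0:ℝ) 1, ∀ b ∈ Set.Icc (0:ℝ) 1, ∀ c ∈ Set.Icc (0:ℝ) 1,
    b ≤ c → Γ a b ≤ Γ a c
  Γ_one : ∀ a ∈ Set.Icc (0:ℝ) 1, Γ a 1 = a
  Γ_mem : ∀ a ∈ Set.Icc (0:ℝ) 1, ∀ b ∈ Set.Icc (0:ℝ) 1, Γ a b ∈ Set.Icc (0:ℝ) 1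
  Γ_cont : ContinuousOn (fun p : ℝ × ℝ => Γ p.1 p.2) (Set.Icc 0 1 ×ˢ Set.Icc 0 1)
  Θ_pos : ∀ u v ρ, 0 < ρ → 0 < Θ u v ρ
  Θ_le_one : ∀ u v ρ, 0 < ρ → Θ u v ρ ≤ 1
  Θ_eq_one_iff : ∀ u v ρ, 0 < ρ → (Θ u v ρ = 1 ↔ u = v)
  Θ_symm : ∀ u v ρ, Θ u v ρ = Θ v u ρ
  Θ_tri : ∀ u v z ρ s, 0 < ρ → 0 < s → Γ (Θ u v ρ) (Θ v z s) ≤ Θ u z (ρ + s)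
  Θ_cont : ∀ u v, ContinuousOn (Θ u v) (Set.Ioi 0)

variable {Ξ : Type*}

/-- Convergence of a sequence in a fuzzy metric space. -/
def FuzzyMetricSpace.Converges (F : FuzzyMetricSpace Ξ) (u : ℕ → Ξ) (x : Ξ) : Prop :=
  ∀ ε ∈ Set.Ioo (0:ℝ) 1, ∀ ρ > (0:ℝ), ∃ N : ℕ, ∀ n ≥ N, 1 - ε < F.Θ (u n) x ρ

/-- G-Cauchy sequences in a fuzzy metric space. -/
def FuzzyMetricSpace.GCauchy (F : FuzzyMetricSpace Ξ) (u : ℕ → Ξ) : Prop :=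
  ∀ p : ℕ, 0 < p → ∀ ε ∈ Set.Ioo (0:ℝ) 1, ∀ ρ > (0:ℝ),
    ∃ N : ℕ, ∀ n ≥ N, 1 - ε < F.Θ (u n) (u (n + p)) ρ

/-- G-completeness: every G-Cauchy sequence converges. -/
def FuzzyMetricSpace.GComplete (F : FuzzyMetricSpace Ξ) : Prop :=
  ∀ u : ℕ → Ξ, F.GCauchy u → ∃ x : Ξ, F.Converges u x

/-- Iterates of a t-norm: `Γ^0(a) = 1`, `Γ^{n+1}(a) = Γ(Γ^n(a), a)`. -/
def tnormIter (Γ : ℝ → ℝ → ℝ) : ℕ → ℝ → ℝ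
  | 0, _ => 1
  | n + 1, a => Γ (tnormIter Γ n a) a

/-- A t-norm of H-type. -/
def FuzzyMetricSpace.HType (F : FuzzyMetricSpace Ξ) : Prop :=
  ∀ ε ∈ Set.Ioo (0:ℝ) 1, ∃ lam ∈ Set.Ioo (0:ℝ) 1,
    ∀ ρ ∈ Set.Icc (0:ℝ) 1, 1 - lam < ρ → ∀ n : ℕ, 1 ≤ n → 1 - ε < tnormIter F.Γ n ρ

/-- The class `Π` of functions `ζ : (0,∞) → (0,∞)` whose iterates tend to `0`. -/
def MemPi (ζ : ℝ → ℝ) : Prop :=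
  (∀ ρ > (0:ℝ), 0 < ζ ρ) ∧ ∀ ρ > (0:ℝ), Tendsto (fun n : ℕ => ζ^[n] ρ) atTop (nhds 0)

/-- Open ball in a fuzzy metric space. -/
def FuzzyMetricSpace.ball (F : FuzzyMetricSpace Ξ) (x : Ξ) (ε ρ : ℝ) : Set Ξ :=
  {y | 1 - ε < F.Θ x y ρ}

/-- The topology induced by a fuzzy metric, generated by the open balls. -/
def FuzzyMetricSpace.topology (F : FuzzyMetricSpace Ξ) : TopologicalSpace Ξ :=
  TopologicalSpace.generateFrom
    {s | ∃ x : Ξ, ∃ ε ∈ Set.Ioo (0:ℝ) 1, ∃ ρ > (0:ℝ), s = F.ball x ε ρ}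

/-- `S` takes values in `K(Ξ)`, the nonempty compact subsets of `Ξ`
(compact with respect to the topology induced by the fuzzy metric). -/
def FuzzyMetricSpace.IsKValued (F : FuzzyMetricSpace Ξ) (S : Ξ → Set Ξ) : Prop :=
  ∀ u : Ξ, (S u).Nonempty ∧ @IsCompact Ξ F.topology (S u)

/-- The Hausdorff fuzzy metric
`Υ(A,B,ρ) = min( inf_{b∈B} sup_{a∈A} Θ(a,b,ρ), inf_{a∈A} sup_{b∈B} Θ(a,b,ρ) )`. -/
noncomputable def FuzzyMetricSpace.hausdorff (F : FuzzyMetricSpace Ξ)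
    (A B : Set Ξ) (ρ : ℝ) : ℝ :=
  min (⨅ b : B, ⨆ a : A, F.Θ (↑a) (↑b) ρ) (⨅ a : A, ⨆ b : B, F.Θ (↑a) (↑b) ρ)

/-- `S` is a `ζ`-contraction multi-valued mapping:
`Υ(S u, S v, ζ(ρ)) ≥ Θ(u, v, ρ)` for all `u, v` and `ρ > 0`. -/
def FuzzyMetricSpace.MultiZetaContraction (F : FuzzyMetricSpace Ξ)
    (S : Ξ → Set Ξ) (ζ : ℝ → ℝ) : Prop :=
  ∀ u v : Ξ, ∀ ρ > (0:ℝ), F.Θ u v ρ ≤ F.hausdorff (S u) (S v) (ζ ρ)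

namespace FuzzyMetricSpace

variable (F : FuzzyMetricSpace Ξ)

lemma Θ_self (x : Ξ) {t : ℝ} (ht : 0 < t) : F.Θ x x t = 1 :=
  (F.Θ_eq_one_iff x x t ht).2 rfl

lemma Θ_mem (x y : Ξ) {t : ℝ} (ht : 0 < t) : F.Θ x y t ∈ Set.Icc (0:ℝ) 1 :=
  ⟨(F.Θ_pos x y t ht).le, F.Θ_le_one x y t ht⟩

lemma Γ_le_Γ {a b c d : ℝ} (ha : a ∈ Set.Icc (0:ℝ) 1) (hb : b ∈ Set.Icc (0:ℝ) 1)
    (hc : c ∈ Set.Icc (0:ℝ) 1) (hd : d ∈ Set.Icc (0:ℝ) 1) (hac : a ≤ c) (hbd : b ≤ d) :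
    F.Γ a b ≤ F.Γ c d := by
  refine (F.Γ_mono a ha b hb d hd hbd).trans ?_
  rw [F.Γ_comm a d, F.Γ_comm c d]
  exact F.Γ_mono d hd a ha c hc hac

lemma Θ_mono (x y : Ξ) {s t : ℝ} (hs : 0 < s) (hst : s ≤ t) : F.Θ x y s ≤ F.Θ x y t := by
  rcases hst.eq_or_lt with rfl | h
  · exact le_rfl
  · have := F.Θ_tri x y y s (t - s) hs (sub_pos.2 h)
    rwa [F.Θ_self y (sub_pos.2 h), F.Γ_one _ (F.Θ_mem x y hs), add_sub_cancel] at this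

lemma exists_tri (ε : ℝ) (hε : ε ∈ Set.Ioo (0:ℝ) 1) : ∃ δ ∈ Set.Ioo (0:ℝ) 1, δ ≤ ε ∧
    ∀ x y z : Ξ, ∀ s > (0:ℝ), ∀ t > (0:ℝ), 1 - δ < F.Θ x y s → 1 - δ < F.Θ y z t →
      1 - ε < F.Θ x z (s + t) := by
  have h1 : (1:ℝ) ∈ Set.Icc (0:ℝ) 1 := by simp
  have hc := F.Γ_cont (1, 1) ⟨h1, h1⟩
  rw [Metric.continuousWithinAt_iff] at hc
  obtain ⟨η, hη, H⟩ := hc ε hε.1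
  refine ⟨min (η / 2) ε, ⟨lt_min (by positivity) hε.1, (min_le_right _ _).trans_lt hε.2⟩,
    min_le_right _ _, fun x y z s hs t ht hxy hyz => ?_⟩
  have hle := min_le_left (η / 2) ε
  have hx := F.Θ_mem x y hs
  have hy := F.Θ_mem y z ht
  have hd : dist (F.Θ x y s, F.Θ y z t) ((1:ℝ), (1:ℝ)) < η := by
    rw [Prod.dist_eq, max_lt_iff, Real.dist_eq, Real.dist_eq, abs_lt, abs_lt]
    refine ⟨⟨?_, ?_⟩, ?_, ?_⟩ <;> dsimp only <;> linarith [hx.2, hy.2]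
  have := H ⟨hx, hy⟩ hd
  rw [Real.dist_eq, abs_lt, F.Γ_one 1 h1] at this
  linarith [F.Θ_tri x y z s t hs ht, this.1]

lemma exists_lt_Γ_left {a b c : ℝ} (ha : a ∈ Set.Ioc (0:ℝ) 1) (hb : b ∈ Set.Icc (0:ℝ) 1)
    (h : c < F.Γ a b) : ∃ a' ∈ Set.Ico 0 a, c < F.Γ a' b := by
  have hc := F.Γ_cont (a, b) ⟨⟨ha.1.le, ha.2⟩, hb⟩
  rw [Metric.continuousWithinAt_iff] at hc
  obtain ⟨η, hη, H⟩ := hc (F.Γ a b - c) (sub_pos.2 h)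
  have hm : 0 < min (η / 2) a := lt_min (by positivity) ha.1
  have hl := min_le_left (η / 2) a
  have hr := min_le_right (η / 2) a
  refine ⟨a - min (η / 2) a, ⟨by linarith, by linarith⟩, ?_⟩
  have hd : dist (a - min (η / 2) a, b) (a, b) < η := by
    rw [Prod.dist_eq, max_lt_iff, dist_self, Real.dist_eq, abs_lt]
    refine ⟨⟨?_, ?_⟩, hη⟩ <;> dsimp only <;> linarith
  have := H ⟨⟨by simp, by dsimp only; linarith [ha.2]⟩, hb⟩ hd
  rw [Real.dist_eq, abs_lt] at this
  linarith [this.1]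

lemma ball_mem_nhds (x : Ξ) {ε t : ℝ} (hε : ε ∈ Set.Ioo (0:ℝ) 1) (ht : 0 < t) :
    F.ball x ε t ∈ @nhds Ξ F.topology x := by
  let := F.topology
  refine IsOpen.mem_nhds (TopologicalSpace.isOpen_generateFrom_of_mem ⟨x, ε, hε, t, ht, rfl⟩) ?_
  change 1 - ε < F.Θ x x t
  rw [F.Θ_self x ht]
  linarith [hε.1]

/-- Sets admitting a finite net for every tolerance `ε` at every time `t`. -/
def TotBounded (B : Set Ξ) : Prop :=
  ∀ ε ∈ Set.Ioo (0:ℝ) 1, ∀ t > (0:ℝ), ∃ T : Set Ξ, T.Finite ∧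
    ∀ x ∈ B, ∃ y ∈ T, 1 - ε < F.Θ x y t

lemma totBounded_of_isCompact {K : Set Ξ} (hK : @IsCompact Ξ F.topology K) : F.TotBounded K := by
  intro ε hε t ht
  let := F.topology
  refine hK.induction_on (p := fun B => ∃ T : Set Ξ, T.Finite ∧ ∀ x ∈ B, ∃ y ∈ T, 1 - ε < F.Θ x y t)
    ⟨∅, Set.finite_empty, by simp⟩ ?_ ?_ ?_
  · rintro s s' hs ⟨T, hT, h⟩
    exact ⟨T, hT, fun x hx => h x (hs hx)⟩
  · rintro s s' ⟨T, hT, h⟩ ⟨T', hT', h'⟩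
    refine ⟨T ∪ T', hT.union hT', ?_⟩
    rintro x (hx | hx)
    · obtain ⟨y, hy, hxy⟩ := h x hx
      exact ⟨y, Or.inl hy, hxy⟩
    · obtain ⟨y, hy, hxy⟩ := h' x hx
      exact ⟨y, Or.inr hy, hxy⟩
  · intro x _
    refine ⟨F.ball x ε t, mem_nhdsWithin_of_mem_nhds (F.ball_mem_nhds x hε ht), {x},
      Set.finite_singleton x, fun y hy => ⟨x, rfl, ?_⟩⟩
    rw [F.Θ_symm]
    exact hy

lemma mem_of_isCompact {K : Set Ξ} (hK : @IsCompact Ξ F.topology K) {x : Ξ}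
    (h : ∀ ε ∈ Set.Ioo (0:ℝ) 1, ∀ t > (0:ℝ), ∃ z ∈ K, 1 - ε < F.Θ z x t) : x ∈ K := by
  by_contra hx
  let := F.topology
  have key : ∃ δ ∈ Set.Ioo (0:ℝ) 1, ∀ z ∈ K, F.Θ z x 1 ≤ 1 - δ := by
    refine hK.induction_on (p := fun B => ∃ δ ∈ Set.Ioo (0:ℝ) 1, ∀ z ∈ B, F.Θ z x 1 ≤ 1 - δ)
      ⟨1 / 2, by norm_num, by simp⟩ ?_ ?_ ?_
    · rintro s s' hs ⟨δ, hδ, h⟩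
      exact ⟨δ, hδ, fun z hz => h z (hs hz)⟩
    · rintro s s' ⟨δ, hδ, h⟩ ⟨δ', hδ', h'⟩
      refine ⟨min δ δ', ⟨lt_min hδ.1 hδ'.1, (min_le_left _ _).trans_lt hδ.2⟩, ?_⟩
      rintro z (hz | hz)
      · linarith [h z hz, min_le_left δ δ']
      · linarith [h' z hz, min_le_right δ δ']
    · intro z hz
      have hne : F.Θ z x (1 + 1) ≠ 1 := fun he =>
        hx ((F.Θ_eq_one_iff z x _ (by norm_num)).1 he ▸ hz)
      have hlt := lt_of_le_of_ne (F.Θ_le_one z x (1 + 1) (by norm_num)) hne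
      have hpos := F.Θ_pos z x (1 + 1) (by norm_num)
      obtain ⟨δ, hδ, -, hd⟩ := F.exists_tri (1 - F.Θ z x (1 + 1)) ⟨by linarith, by linarith⟩
      refine ⟨F.ball z δ 1, mem_nhdsWithin_of_mem_nhds (F.ball_mem_nhds z hδ one_pos), δ, hδ,
        fun y hy => ?_⟩
      by_contra! hyx
      have := hd z y x 1 one_pos 1 one_pos hy hyx
      linarith
  obtain ⟨δ, hδ, hd⟩ := key
  obtain ⟨z, hz, hzx⟩ := h δ hδ 1 one_pos
  linarith [hd z hz]

/-- A sequence that eventually stays near finite sets, at every scale, has a G-Cauchy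
subsequence. -/
lemma exists_gCauchy_subseq (x : ℕ → Ξ)
    (h : ∀ ε ∈ Set.Ioo (0:ℝ) 1, ∀ t > (0:ℝ), ∃ T : Set Ξ, T.Finite ∧
      ∀ᶠ k in atTop, ∃ y ∈ T, 1 - ε < F.Θ (x k) y t) :
    ∃ φ : ℕ → ℕ, StrictMono φ ∧ F.GCauchy (x ∘ φ) := by
  let U : Ultrafilter ℕ := hyperfilter ℕ
  have hU : (U : Filter ℕ) ≤ atTop := Nat.hyperfilter_le_atTop
  have hnear : ∀ ε ∈ Set.Ioo (0:ℝ) 1, ∀ t > (0:ℝ), ∃ y, ∀ᶠ k in (U : Filter ℕ),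
      1 - ε < F.Θ (x k) y t := by
    intro ε hε t ht
    obtain ⟨T, hT, hk⟩ := h ε hε t ht
    have hmem : (⋃ y ∈ T, {k | 1 - ε < F.Θ (x k) y t}) ∈ U := by
      filter_upwards [hU hk] with k hk
      simpa using hk
    obtain ⟨y, -, hy⟩ := (Ultrafilter.finite_biUnion_mem_iff hT).1 hmem
    exact ⟨y, hy⟩
  have hinv : ∀ i : ℕ, (1 : ℝ) / (i + 2) ∈ Set.Ioo (0:ℝ) 1 := fun i =>
    ⟨by positivity, by rw [div_lt_one (by positivity)]; linarith [i.cast_nonneg (α := ℝ)]⟩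
  choose y hy using fun i : ℕ => hnear (1 / (i + 2)) (hinv i) (1 / (i + 2)) (hinv i).1
  obtain ⟨φ, hφ, hp⟩ := extraction_forall_of_frequently
    (P := fun n k => ∀ i ∈ Set.Iic n, 1 - 1 / ((i:ℝ) + 2) < F.Θ (x k) (y i) (1 / (i + 2)))
    (fun n => ((Set.finite_Iic n).eventually_all.2 fun i _ => hy i).frequently.filter_mono hU)
  refine ⟨φ, hφ, fun p _ ε hε t ht => ?_⟩
  obtain ⟨δ, hδ, -, hd⟩ := F.exists_tri ε hε
  obtain ⟨i, hi⟩ := exists_nat_one_div_lt (lt_min hδ.1 (half_pos ht))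
  have hi' : 1 / ((i:ℝ) + 2) < min δ (t / 2) :=
    (one_div_le_one_div_of_le (by positivity) (by linarith)).trans_lt hi
  have hclose : ∀ n ≥ i, 1 - δ < F.Θ (x (φ n)) (y i) (t / 2) := by
    intro n hn
    have h1 := hp n i hn
    have h2 := F.Θ_mono (x (φ n)) (y i) (hinv i).1 (hi'.le.trans (min_le_right _ _))
    linarith [hi'.trans_le (min_le_left _ _)]
  refine ⟨i, fun n hn => ?_⟩
  have := hd _ _ (x (φ (n + p))) _ (half_pos ht) _ (half_pos ht) (hclose n hn)
    (by rw [F.Θ_symm]; exact hclose (n + p) (by omega))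
  rwa [add_halves] at this

variable {F} {S : Ξ → Set Ξ} {ζ : ℝ → ℝ}

lemma MultiZetaContraction.exists_lt (hS : F.MultiZetaContraction S ζ) (hSK : F.IsKValued S)
    (hζ : MemPi ζ) {u v x : Ξ} {ρ c : ℝ} (hρ : 0 < ρ) (hx : x ∈ S u) (h : c < F.Θ u v ρ) :
    ∃ y ∈ S v, c < F.Θ x y (ζ ρ) := by
  have h1 : c < ⨅ a : S u, ⨆ b : S v, F.Θ a b (ζ ρ) :=
    h.trans_le ((hS u v ρ hρ).trans (min_le_right _ _))
  have hb : BddBelow (Set.range fun a : S u => ⨆ b : S v, F.Θ a b (ζ ρ)) := by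
    refine ⟨0, ?_⟩
    rintro _ ⟨a, rfl⟩
    exact Real.iSup_nonneg fun b => (F.Θ_pos _ _ _ (hζ.1 ρ hρ)).le
  have h2 := h1.trans_le (ciInf_le hb ⟨x, hx⟩)
  have : Nonempty (S v) := (hSK v).1.to_subtype
  obtain ⟨y, hy⟩ := exists_lt_of_lt_ciSup h2
  exact ⟨y, y.2, hy⟩

end FuzzyMetricSpace

lemma MemPi.iterate_pos {ζ : ℝ → ℝ} (hζ : MemPi ζ) {ρ : ℝ} (hρ : 0 < ρ) (n : ℕ) :
    0 < ζ^[n] ρ := by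
  induction n with
  | zero => exact hρ
  | succ n ih => rw [Function.iterate_succ_apply']; exact hζ.1 _ ih

lemma MemPi.exists_lt {ζ : ℝ → ℝ} (hζ : MemPi ζ) {t : ℝ} (ht : 0 < t) : ∃ r ≥ t, ζ r < t := by
  by_contra! H
  have hge : ∀ n, t ≤ ζ^[n] t := by
    intro n
    induction n with
    | zero => exact le_rfl
    | succ n ih => rw [Function.iterate_succ_apply']; exact H _ ih
  exact ht.not_ge (ge_of_tendsto' (hζ.2 t ht) hge)

/-- The `n`-th image of the point `u` under the multi-valued mapping `S`. -/
def iterImage (S : Ξ → Set Ξ) (u : Ξ) : ℕ → Set Ξ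
  | 0 => {u}
  | n + 1 => {x | ∃ w ∈ iterImage S u n, x ∈ S w}

namespace FuzzyMetricSpace

variable {F : FuzzyMetricSpace Ξ} {S : Ξ → Set Ξ} {ζ : ℝ → ℝ}

lemma totBounded_iterImage (hS : F.MultiZetaContraction S ζ) (hSK : F.IsKValued S)
    (hζ : MemPi ζ) (u : Ξ) (n : ℕ) : F.TotBounded (iterImage S u n) := by
  induction n with
  | zero =>
    intro ε hε t ht
    refine ⟨{u}, Set.finite_singleton u, fun x hx => ⟨u, rfl, ?_⟩⟩
    rw [show x = u from hx, F.Θ_self u ht]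
    linarith [hε.1]
  | succ n ih =>
    intro ε hε t ht
    obtain ⟨δ, hδ, -, hd⟩ := F.exists_tri ε hε
    obtain ⟨r, hr, hζr⟩ := hζ.exists_lt (half_pos ht)
    have hr0 : 0 < r := (half_pos ht).trans_le hr
    obtain ⟨T, hT, hnet⟩ := ih δ hδ r hr0
    choose N hN hNnet using fun v =>
      F.totBounded_of_isCompact (hSK v).2 δ hδ (t / 2) (half_pos ht)
    refine ⟨⋃ v ∈ T, N v, hT.biUnion fun v _ => hN v, ?_⟩
    rintro x ⟨w, hw, hx⟩
    obtain ⟨v, hv, hwv⟩ := hnet w hw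
    obtain ⟨y, hy, hxy⟩ := hS.exists_lt hSK hζ hr0 hx hwv
    obtain ⟨z, hz, hyz⟩ := hNnet v y hy
    refine ⟨z, Set.mem_biUnion hv hz, ?_⟩
    have := hd x y z _ (half_pos ht) _ (half_pos ht)
      (hxy.trans_le (F.Θ_mono x y (hζ.1 r hr0) hζr.le)) hyz
    rwa [add_halves] at this

lemma iterImage_succ_near (hS : F.MultiZetaContraction S ζ) (hSK : F.IsKValued S)
    (hζ : MemPi ζ) (hlim : ∀ u v : Ξ, Tendsto (fun ρ => F.Θ u v ρ) atTop (nhds 1)) (u : Ξ)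
    {ε : ℝ} (hε : ε ∈ Set.Ioo (0:ℝ) 1) {t : ℝ} (ht : 0 < t) :
    ∃ N, ∀ n ≥ N, ∀ x ∈ iterImage S u (n + 1), ∃ y ∈ iterImage S u n, 1 - ε < F.Θ x y t := by
  obtain ⟨δ, hδ, -, hd⟩ := F.exists_tri ε hε
  obtain ⟨T, hT, hnet⟩ := F.totBounded_of_isCompact (hSK u).2 δ hδ 1 one_pos
  have hev : ∀ᶠ ρ : ℝ in atTop, 0 < ρ ∧ ∀ y ∈ T, 1 - δ < F.Θ y u ρ :=
    (eventually_gt_atTop 0).and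
      (hT.eventually_all.2 fun y _ => (hlim y u).eventually (lt_mem_nhds (by linarith [hδ.1])))
  obtain ⟨ρ, hρ, hρT⟩ := hev.exists
  have hρ1 : 0 < 1 + ρ := by linarith
  have hn : ∀ n, ∀ x ∈ iterImage S u (n + 1), ∃ y ∈ iterImage S u n,
      1 - ε < F.Θ x y (ζ^[n] (1 + ρ)) := by
    intro n
    induction n with
    | zero =>
      rintro x ⟨w, rfl, hx⟩
      obtain ⟨y, hy, hxy⟩ := hnet x hx
      exact ⟨w, rfl, hd x y w 1 one_pos ρ hρ hxy (hρT y hy)⟩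
    | succ n ih =>
      rintro x ⟨w, hw, hx⟩
      obtain ⟨v, hv, hwv⟩ := ih w hw
      obtain ⟨y, hy, hxy⟩ := hS.exists_lt hSK hζ (hζ.iterate_pos hρ1 n) hx hwv
      rw [Function.iterate_succ_apply']
      exact ⟨y, ⟨v, hv, hy⟩, hxy⟩
  obtain ⟨N, hN⟩ := eventually_atTop.1 ((hζ.2 _ hρ1).eventually (gt_mem_nhds ht))
  refine ⟨N, fun n hnN x hx => ?_⟩
  obtain ⟨y, hy, hxy⟩ := hn n x hx
  exact ⟨y, hy, hxy.trans_le (F.Θ_mono x y (hζ.iterate_pos hρ1 n) (hN n hnN).le)⟩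

lemma iterImage_near (hS : F.MultiZetaContraction S ζ) (hSK : F.IsKValued S)
    (hζ : MemPi ζ) (hH : F.HType)
    (hlim : ∀ u v : Ξ, Tendsto (fun ρ => F.Θ u v ρ) atTop (nhds 1)) (u : Ξ)
    {ε : ℝ} (hε : ε ∈ Set.Ioo (0:ℝ) 1) {t : ℝ} (ht : 0 < t) :
    ∃ N, ∀ k, ∀ x ∈ iterImage S u (N + k), ∃ y ∈ iterImage S u N, 1 - ε < F.Θ x y t := by
  obtain ⟨l, hl, hiter⟩ := hH ε hε
  set a : ℝ := 1 - l / 2 with ha_def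
  have ha : a ∈ Set.Icc (0:ℝ) 1 := ⟨by linarith [hl.2], by linarith [hl.1]⟩
  have hbound : ∀ k, 1 - ε < tnormIter F.Γ k a := by
    intro k
    rcases Nat.eq_zero_or_pos k with rfl | hk
    · change 1 - ε < 1
      linarith [hε.1]
    · exact hiter a ha (by linarith [hl.1]) k hk
  have hmem : ∀ k, tnormIter F.Γ k a ∈ Set.Icc (0:ℝ) 1 := by
    intro k
    induction k with
    | zero => exact ⟨zero_le_one, le_rfl⟩
    | succ k ih => exact F.Γ_mem _ ih _ ha
  obtain ⟨r, hr, hζr⟩ := hζ.exists_lt ht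
  have hr0 : 0 < r := ht.trans_le hr
  have hgap : 0 < t - ζ r := sub_pos.2 hζr
  obtain ⟨N, hN⟩ := iterImage_succ_near hS hSK hζ hlim u
    (ε := l / 2) ⟨by linarith [hl.1], by linarith [hl.2]⟩ hgap
  have hk : ∀ k, ∀ c < tnormIter F.Γ k a, ∀ x ∈ iterImage S u (N + k),
      ∃ y ∈ iterImage S u N, c < F.Θ x y t := by
    intro k
    induction k with
    | zero =>
      intro c hc x hx
      exact ⟨x, hx, by rw [F.Θ_self x ht]; exact hc⟩
    | succ k ih =>
      rintro c hc x ⟨w, hw, hx⟩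
      obtain ⟨c', hc', hcc'⟩ := F.exists_lt_Γ_left
        ⟨by linarith [hbound k, hε.2], (hmem k).2⟩ ha hc
      obtain ⟨v, hv, hwv⟩ := ih c' hc'.2 w hw
      obtain ⟨y, hy, hxy⟩ := hS.exists_lt hSK hζ hr0 hx (hwv.trans_le (F.Θ_mono w v ht hr))
      obtain ⟨z, hz, hyz⟩ := hN N le_rfl y ⟨v, hv, hy⟩
      refine ⟨z, hz, hcc'.trans_le ?_⟩
      have htri := F.Θ_tri x y z (ζ r) (t - ζ r) (hζ.1 r hr0) hgap
      rw [add_sub_cancel] at htri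
      exact (F.Γ_le_Γ ⟨hc'.1, hc'.2.le.trans (hmem k).2⟩ ha (F.Θ_mem x y (hζ.1 r hr0))
        (F.Θ_mem y z hgap) hxy.le hyz.le).trans htri
  exact ⟨N, fun k => hk k _ (hbound k)⟩

lemma exists_almost_fixed (hS : F.MultiZetaContraction S ζ) (hSK : F.IsKValued S)
    (hζ : MemPi ζ) (hlim : ∀ u v : Ξ, Tendsto (fun ρ => F.Θ u v ρ) atTop (nhds 1)) (u : Ξ)
    {ε : ℝ} (hε : 0 < ε) {t : ℝ} (ht : 0 < t) (m : ℕ) :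
    ∃ n ≥ m, ∃ x ∈ iterImage S u n, ∃ y ∈ S x, 1 - ε < F.Θ x y t := by
  obtain ⟨v, hv⟩ := (hSK u).1
  obtain ⟨ρ, hρ, hρv⟩ := ((eventually_gt_atTop (0:ℝ)).and
    ((hlim u v).eventually (lt_mem_nhds (sub_lt_self 1 hε)))).exists
  have hn : ∀ n, ∃ x ∈ iterImage S u n, ∃ y ∈ S x, 1 - ε < F.Θ x y (ζ^[n] ρ) := by
    intro n
    induction n with
    | zero => exact ⟨u, rfl, v, hv, hρv⟩
    | succ n ih =>
      obtain ⟨x, hx, y, hy, hxy⟩ := ih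
      obtain ⟨z, hz, hyz⟩ := hS.exists_lt hSK hζ (hζ.iterate_pos hρ n) hy hxy
      rw [Function.iterate_succ_apply']
      exact ⟨y, ⟨x, hx, hy⟩, z, hz, hyz⟩
  obtain ⟨n, hnt, hnm⟩ := (((hζ.2 ρ hρ).eventually (gt_mem_nhds ht)).and
    (eventually_ge_atTop m)).exists
  obtain ⟨x, hx, y, hy, hxy⟩ := hn n
  exact ⟨n, hnm, x, hx, y, hy, hxy.trans_le (F.Θ_mono x y (hζ.iterate_pos hρ n) hnt.le)⟩

end FuzzyMetricSpace

/-- Theorem (fixed point for ζ-contraction multi-valued mappings). -/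
theorem multi_zeta_contraction_fixed_point
    {Ξ : Type*} [Nonempty Ξ] (F : FuzzyMetricSpace Ξ)
    (hcomp : F.GComplete) (hH : F.HType)
    (hlim : ∀ u v : Ξ, Tendsto (fun ρ => F.Θ u v ρ) atTop (nhds 1))
    (ζ : ℝ → ℝ) (hζ : MemPi ζ)
    (S : Ξ → Set Ξ) (hSK : F.IsKValued S)
    (hS : F.MultiZetaContraction S ζ) :
    ∃ u : Ξ, u ∈ S u := by
  obtain ⟨u⟩ := ‹Nonempty Ξ›
  have hinv : ∀ i : ℕ, (0 : ℝ) < 1 / (i + 1) := fun i => by positivity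
  choose n hn x hx y hy hxy using fun i : ℕ =>
    FuzzyMetricSpace.exists_almost_fixed hS hSK hζ hlim u (hinv i) (hinv i) i
  obtain ⟨φ, hφ, hφc⟩ := F.exists_gCauchy_subseq x fun ε hε t ht => by
    obtain ⟨δ, hδ, -, hd⟩ := F.exists_tri ε hε
    obtain ⟨N, hN⟩ := FuzzyMetricSpace.iterImage_near hS hSK hζ hH hlim u hδ (half_pos ht)
    obtain ⟨T, hT, hnet⟩ :=
      FuzzyMetricSpace.totBounded_iterImage hS hSK hζ u N δ hδ (t / 2) (half_pos ht)
    refine ⟨T, hT, eventually_atTop.2 ⟨N, fun k hk => ?_⟩⟩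
    obtain ⟨v, hv, hkv⟩ := hN (n k - N) (x k) (by
      rw [Nat.add_sub_cancel' (hk.trans (hn k))]
      exact hx k)
    obtain ⟨w, hw, hvw⟩ := hnet v hv
    have := hd _ _ _ _ (half_pos ht) _ (half_pos ht) hkv hvw
    rw [add_halves] at this
    exact ⟨w, hw, this⟩
  obtain ⟨z, hz⟩ := hcomp _ hφc
  refine ⟨z, F.mem_of_isCompact (hSK z).2 fun ε hε t ht => ?_⟩
  obtain ⟨δ, hδ, -, hd⟩ := F.exists_tri ε hε
  obtain ⟨η, hη, hηδ, he⟩ := F.exists_tri δ hδ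
  have ht2 := half_pos ht
  have ht4 := half_pos ht2
  obtain ⟨r, hr, hζr⟩ := hζ.exists_lt ht2
  have hr0 : 0 < r := ht2.trans_le hr
  obtain ⟨N₁, hN₁⟩ := hz η hη r hr0
  obtain ⟨N₂, hN₂⟩ := hz η hη (t / 2 / 2) ht4
  obtain ⟨i, hi⟩ := exists_nat_one_div_lt (lt_min hη.1 ht4)
  set m := max (max N₁ N₂) i
  have hm : i ≤ φ m := (le_max_right _ _).trans (hφ.id_le m)
  have hm' : (1 : ℝ) / (φ m + 1) < min η (t / 2 / 2) :=
    (one_div_le_one_div_of_le (by positivity) (by gcongr)).trans_lt hi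
  obtain ⟨w, hw, hyw⟩ := hS.exists_lt hSK hζ hr0 (hy (φ m))
    (hN₁ m ((le_max_left _ _).trans (le_max_left _ _)))
  have h₁ : 1 - δ < F.Θ w (y (φ m)) (t / 2) := by
    rw [F.Θ_symm]
    linarith [F.Θ_mono (y (φ m)) w (hζ.1 r hr0) hζr.le]
  have h₂ : 1 - η < F.Θ (y (φ m)) (x (φ m)) (t / 2 / 2) := by
    rw [F.Θ_symm]
    linarith [hxy (φ m), hm'.trans_le (min_le_left _ _),
      F.Θ_mono (x (φ m)) (y (φ m)) (hinv (φ m)) (hm'.le.trans (min_le_right _ _))]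
  have h₃ := he _ _ _ _ ht4 _ ht4 h₂ (hN₂ m ((le_max_right _ _).trans (le_max_left _ _)))
  rw [add_halves] at h₃
  have h₄ := hd _ _ _ _ ht2 _ ht2 h₁ h₃
  rw [add_halves] at h₄
  exact ⟨w, hw, h₄⟩
end

section
/- Let (Ξ,Θ,Γ) be a G-complete fuzzy metric space whose t-norm Γ is of H-type and such that lim_{ρ→∞} Θ(u,v,ρ) = 1 for all u,v ∈ Ξ. If f : Ξ → Ξ is a ζ-contraction mapping for some ζ ∈ Π, then f possesses a unique fixed point z ∈ Ξ; moreover, for every u ∈ Ξ the sequence of iterates {f^n u} converges to z. -/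
open Filter Topology

variable {Ξ : Type*}

namespace FuzzyMetricSpace

variable (F : FuzzyMetricSpace Ξ)

theorem Θ_mem_Icc (u v : Ξ) {ρ : ℝ} (hρ : 0 < ρ) : F.Θ u v ρ ∈ Set.Icc (0 : ℝ) 1 :=
  ⟨(F.Θ_pos u v ρ hρ).le, F.Θ_le_one u v ρ hρ⟩

theorem Θ_mono_s4 (u v : Ξ) {ρ s : ℝ} (hρ : 0 < ρ) (h : ρ ≤ s) : F.Θ u v ρ ≤ F.Θ u v s := by
  rcases h.eq_or_lt with rfl | h
  · exact le_rfl
  have htri := F.Θ_tri u v v ρ (s - ρ) hρ (sub_pos.2 h)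
  rwa [(F.Θ_eq_one_iff v v (s - ρ) (sub_pos.2 h)).2 rfl,
    F.Γ_one _ (F.Θ_mem_Icc u v hρ), add_sub_cancel] at htri

theorem converges_iff_tendsto {u : ℕ → Ξ} {x : Ξ} :
    F.Converges u x ↔ ∀ ρ > (0 : ℝ), Tendsto (fun n => F.Θ (u n) x ρ) atTop (𝓝 1) := by
  constructor
  · intro h ρ hρ
    refine tendsto_order.2 ⟨fun a ha => ?_, fun a ha =>
      Eventually.of_forall fun n => (F.Θ_le_one _ _ _ hρ).trans_lt ha⟩
    obtain ⟨N, hN⟩ := h (min (1 - a) (1 / 2))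
      ⟨lt_min (by linarith) (by norm_num), (min_le_right _ _).trans_lt (by norm_num)⟩ ρ hρ
    filter_upwards [eventually_ge_atTop N] with n hn
    linarith [hN n hn, min_le_left (1 - a) (1 / 2)]
  · intro h ε hε ρ hρ
    exact eventually_atTop.1 ((h ρ hρ).eventually (lt_mem_nhds (by linarith [hε.1])))

theorem Converges.unique {F : FuzzyMetricSpace Ξ} {u : ℕ → Ξ} {x y : Ξ}
    (hx : F.Converges u x) (hy : F.Converges u y) : x = y := by
  rw [converges_iff_tendsto] at hx hy
  have hone : (1 : ℝ) ∈ Set.Icc (0 : ℝ) 1 := by simp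
  have hpair : Tendsto (fun n => (F.Θ (u n) x 1, F.Θ (u n) y 1)) atTop
      (𝓝[Set.Icc 0 1 ×ˢ Set.Icc 0 1] ((1 : ℝ), (1 : ℝ))) :=
    tendsto_nhdsWithin_iff.2 ⟨(hx 1 one_pos).prodMk_nhds (hy 1 one_pos),
      Eventually.of_forall fun n => ⟨F.Θ_mem_Icc _ _ one_pos, F.Θ_mem_Icc _ _ one_pos⟩⟩
  have hΓ := (F.Γ_cont (1, 1) ⟨hone, hone⟩).tendsto.comp hpair
  simp only [F.Γ_one 1 hone] at hΓ
  refine (F.Θ_eq_one_iff x y (1 + 1) (by norm_num)).1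
    (le_antisymm (F.Θ_le_one _ _ _ (by norm_num)) (le_of_tendsto' hΓ fun n => ?_))
  have htri := F.Θ_tri x (u n) y 1 1 one_pos one_pos
  rwa [F.Θ_symm x (u n)] at htri

variable {F} {ζ : ℝ → ℝ} {f : Ξ → Ξ}

theorem Θ_le_Θ_iterate (hζ : MemPi ζ)
    (hf : ∀ u v : Ξ, ∀ ρ > (0 : ℝ), F.Θ u v ρ ≤ F.Θ (f u) (f v) (ζ ρ))
    (u v : Ξ) {ρ : ℝ} (hρ : 0 < ρ) (n : ℕ) :
    0 < ζ^[n] ρ ∧ F.Θ u v ρ ≤ F.Θ (f^[n] u) (f^[n] v) (ζ^[n] ρ) := by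
  induction n with
  | zero => exact ⟨hρ, le_rfl⟩
  | succ n ih =>
    simp only [Function.iterate_succ_apply']
    exact ⟨hζ.1 _ ih.1, ih.2.trans (hf _ _ _ ih.1)⟩

theorem tendsto_Θ_iterate (hlim : ∀ u v : Ξ, Tendsto (fun ρ => F.Θ u v ρ) atTop (𝓝 1))
    (hζ : MemPi ζ) (hf : ∀ u v : Ξ, ∀ ρ > (0 : ℝ), F.Θ u v ρ ≤ F.Θ (f u) (f v) (ζ ρ))
    (u v : Ξ) {s : ℝ} (hs : 0 < s) :
    Tendsto (fun n => F.Θ (f^[n] u) (f^[n] v) s) atTop (𝓝 1) := by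
  refine tendsto_order.2 ⟨fun a ha => ?_, fun a ha =>
    Eventually.of_forall fun n => (F.Θ_le_one _ _ _ hs).trans_lt ha⟩
  obtain ⟨ρ, haρ, hρ⟩ :=
    (((hlim u v).eventually (lt_mem_nhds ha)).and (eventually_gt_atTop 0)).exists
  filter_upwards [(hζ.2 ρ hρ).eventually (gt_mem_nhds hs)] with n hn
  obtain ⟨hpos, hle⟩ := Θ_le_Θ_iterate hζ hf u v hρ n
  exact haρ.trans_le (hle.trans (F.Θ_mono_s4 _ _ hpos hn.le))

theorem Converges.map (hζ : MemPi ζ)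
    (hf : ∀ u v : Ξ, ∀ ρ > (0 : ℝ), F.Θ u v ρ ≤ F.Θ (f u) (f v) (ζ ρ))
    {u : ℕ → Ξ} {x : Ξ} (h : F.Converges u x) : F.Converges (fun n => f (u n)) (f x) := by
  intro ε hε s hs
  obtain ⟨ρ, hρ, hρs⟩ : ∃ ρ > (0 : ℝ), ζ ρ < s := by
    obtain ⟨n, hn⟩ := (((tendsto_add_atTop_iff_nat 1).2 (hζ.2 1 one_pos)).eventually
      (gt_mem_nhds hs)).exists
    rw [Function.iterate_succ_apply'] at hn
    exact ⟨ζ^[n] 1, (Θ_le_Θ_iterate hζ hf x x one_pos n).1, hn⟩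
  obtain ⟨N, hN⟩ := h ε hε ρ hρ
  exact ⟨N, fun n hn => (hN n hn).trans_le
    ((hf _ _ _ hρ).trans (F.Θ_mono_s4 _ _ (hζ.1 _ hρ) hρs.le))⟩

end FuzzyMetricSpace

/-- Theorem (unique fixed point for single-valued ζ-contractions). -/
theorem zeta_contraction_unique_fixed_point
    {Ξ : Type*} [Nonempty Ξ] (F : FuzzyMetricSpace Ξ)
    (hcomp : F.GComplete) (hH : F.HType)
    (hlim : ∀ u v : Ξ, Tendsto (fun ρ => F.Θ u v ρ) atTop (nhds 1))
    (ζ : ℝ → ℝ) (hζ : MemPi ζ) (f : Ξ → Ξ)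
    (hf : ∀ u v : Ξ, ∀ ρ > (0:ℝ), F.Θ u v ρ ≤ F.Θ (f u) (f v) (ζ ρ)) :
    ∃ z : Ξ, f z = z ∧ (∀ v : Ξ, f v = v → v = z) ∧
      ∀ u : Ξ, F.Converges (fun n : ℕ => f^[n] u) z := by
  have hconv (u v : Ξ) {s : ℝ} (hs : 0 < s) :=
    FuzzyMetricSpace.tendsto_Θ_iterate hlim hζ hf u v hs
  obtain ⟨u₀⟩ := ‹Nonempty Ξ›
  obtain ⟨z, hz⟩ := hcomp (fun n => f^[n] u₀) fun p _ ε hε ρ hρ => by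
    simp only [Function.iterate_add_apply]
    exact eventually_atTop.1
      ((hconv u₀ (f^[p] u₀) hρ).eventually (lt_mem_nhds (by linarith [hε.1])))
  have hshift : F.Converges (fun n => f (f^[n] u₀)) z := by
    intro ε hε ρ hρ
    obtain ⟨N, hN⟩ := hz ε hε ρ hρ
    refine ⟨N, fun n hn => ?_⟩
    simpa only [Function.iterate_succ_apply'] using hN (n + 1) (by omega)
  have hfix : f z = z := (hz.map hζ hf).unique hshift
  have hall (u : Ξ) : F.Converges (fun n => f^[n] u) z := by
    rw [F.converges_iff_tendsto]
    intro ρ hρ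
    simpa only [Function.iterate_fixed hfix] using hconv u z hρ
  refine ⟨z, hfix, fun v hv => ?_, hall⟩
  have hvz := F.converges_iff_tendsto.1 (hall v) 1 one_pos
  simp only [Function.iterate_fixed hv] at hvz
  exact (F.Θ_eq_one_iff v z 1 one_pos).1 (tendsto_nhds_unique tendsto_const_nhds hvz)
end
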